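/- Syntactic Disjunction Property: for every P ∈ {ICK, ICKT, ICKS4} and all formulae φ, ψ of L_ICK, if ⊢_P φ ∨ ψ, then ⊢_P φ or ⊢_P ψ. -/

import Mathlib

namespace ICK

/-- Formulae of the language `L_ICK` over a type of agents and natural-number atoms. -/
inductive Formula (Agent : Type) : Type
  | bot : Formula Agent
  | atom : ℕ → Formula Agent
  | and : Formula Agent → Formula Agent → Formula Agent
  | or : Formula Agent → Formula Agent → Formula Agent
  | imp : Formula Agent → Formula Agent → Formula Agent
  | know : Agent → Formula Agent → Formula Agent
  | ck : Formula Agent → Formula Agent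

namespace Formula

variable {Agent : Type}

/-- `¬φ := φ → ⊥`. -/
def neg (φ : Formula Agent) : Formula Agent := φ.imp Formula.bot

/-- `⊤ := ⊥ → ⊥`. -/
def top : Formula Agent := Formula.imp Formula.bot Formula.bot

/-- `φ ↔ ψ := (φ → ψ) ∧ (ψ → φ)`. -/
def biimp (φ ψ : Formula Agent) : Formula Agent := (φ.imp ψ).and (ψ.imp φ)

end Formula

/-- The formula `E φ = ⋀_{a ∈ A} K_a φ` (everybody knows). -/
noncomputable def Efml {Agent : Type} [Fintype Agent] (φ : Formula Agent) : Formula Agent :=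
  (Finset.univ : Finset Agent).toList.foldr (fun a ψ => (Formula.know a φ).and ψ) Formula.top

/-- Purely propositional formulae (for intuitionistic tautologies). -/
inductive PropForm : Type
  | bot : PropForm
  | atom : ℕ → PropForm
  | and : PropForm → PropForm → PropForm
  | or : PropForm → PropForm → PropForm
  | imp : PropForm → PropForm → PropForm

/-- Kripke models for intuitionistic propositional logic. -/
structure IModel (W : Type) where
  le : W → W → Prop
  le_refl : ∀ w, le w w
  le_trans : ∀ w v u, le w v → le v u → le w u
  V : W → ℕ → Prop
  mono : ∀ w v, le w v → ∀ n, V w n → V v n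

def ISat {W : Type} (M : IModel W) : PropForm → W → Prop
  | .bot, _ => False
  | .atom n, w => M.V w n
  | .and p q, w => ISat M p w ∧ ISat M q w
  | .or p q, w => ISat M p w ∨ ISat M q w
  | .imp p q, w => ∀ v, M.le w v → ISat M p v → ISat M q v

/-- IPC validity of a propositional formula. -/
def IPCValid (p : PropForm) : Prop := ∀ (W : Type) (M : IModel W) (w : W), ISat M p w

/-- Substitution of `L_ICK`-formulae for atoms in a propositional formula. -/
def PropForm.subst {Agent : Type} (σ : ℕ → Formula Agent) : PropForm → Formula Agent
  | .bot => Formula.bot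
  | .atom n => σ n
  | .and p q => (p.subst σ).and (q.subst σ)
  | .or p q => (p.subst σ).or (q.subst σ)
  | .imp p q => (p.subst σ).imp (q.subst σ)

/-- The four Hilbert systems. -/
inductive Sys : Type
  | ick : Sys
  | ickt : Sys
  | icks4 : Sys
  | icks5 : Sys

/-- Systems containing the factivity axiom `T`. -/
def Sys.hasT : Sys → Prop
  | Sys.ick => False
  | _ => True

/-- Systems containing the positive introspection axiom `S4`. -/
def Sys.hasS4 : Sys → Prop
  | Sys.icks4 => True
  | Sys.icks5 => True
  | _ => False

/-- Systems containing the classicality and negative introspection axioms. -/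
def Sys.hasS5 : Sys → Prop
  | Sys.icks5 => True
  | _ => False

/-- Axioms of the Hilbert systems. -/
inductive Ax (Agent : Type) [Fintype Agent] : Sys → Formula Agent → Prop
  | taut (P : Sys) (p : PropForm) (σ : ℕ → Formula Agent) :
      IPCValid p → Ax Agent P (p.subst σ)
  | axK (P : Sys) (a : Agent) (φ ψ : Formula Agent) :
      Ax Agent P ((Formula.know a (φ.imp ψ)).imp ((Formula.know a φ).imp (Formula.know a ψ)))
  | fix (P : Sys) (φ : Formula Agent) :
      Ax Agent P ((Formula.ck φ).biimp (φ.and (Efml (Formula.ck φ))))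
  | axT (P : Sys) (a : Agent) (φ : Formula Agent) :
      P.hasT → Ax Agent P ((Formula.know a φ).imp φ)
  | axS4 (P : Sys) (a : Agent) (φ : Formula Agent) :
      P.hasS4 → Ax Agent P ((Formula.know a φ).imp (Formula.know a (Formula.know a φ)))
  | axKc (P : Sys) (a : Agent) (φ ψ : Formula Agent) :
      P.hasS5 → Ax Agent P (((Formula.know a φ).imp ψ).imp (((Formula.know a φ).neg).or ψ))
  | axS5 (P : Sys) (a : Agent) (φ : Formula Agent) :
      P.hasS5 → Ax Agent P (((Formula.know a φ).neg).imp (Formula.know a ((Formula.know a φ).neg)))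

/-- Theoremhood (derivability without assumptions) in system `P`. -/
inductive Thm (Agent : Type) [Fintype Agent] (P : Sys) : Formula Agent → Prop
  | ax {φ : Formula Agent} : Ax Agent P φ → Thm Agent P φ
  | mp {φ ψ : Formula Agent} : Thm Agent P (φ.imp ψ) → Thm Agent P φ → Thm Agent P ψ
  | nec {φ : Formula Agent} (a : Agent) : Thm Agent P φ → Thm Agent P (Formula.know a φ)
  | mon {φ ψ : Formula Agent} :
      Thm Agent P (φ.imp ψ) → Thm Agent P ((Formula.ck φ).imp (Formula.ck ψ))
  | ind {φ : Formula Agent} :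
      Thm Agent P (φ.imp (Efml φ)) → Thm Agent P (φ.imp (Formula.ck φ))

/-- Derivability of `φ` from assumptions `Γ` in system `P`: the rules of
necessitation, monotonicity and induction may only be applied in
assumption-free subderivations. -/
inductive Deriv (Agent : Type) [Fintype Agent] (P : Sys) (Γ : Set (Formula Agent)) :
    Formula Agent → Prop
  | assum {φ : Formula Agent} : φ ∈ Γ → Deriv Agent P Γ φ
  | thm {φ : Formula Agent} : Thm Agent P φ → Deriv Agent P Γ φ
  | mp {φ ψ : Formula Agent} :
      Deriv Agent P Γ (φ.imp ψ) → Deriv Agent P Γ φ → Deriv Agent P Γ ψ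

namespace Thm

variable {Agent : Type} [Fintype Agent] {P : Sys} {α β γ : Formula Agent}

/-- Instances of intuitionistic tautologies in three propositional variables are theorems. -/
theorem of_valid (p : PropForm) (hp : IPCValid p) (α β γ : Formula Agent) :
    Thm Agent P (p.subst fun n => match n with | 0 => α | 1 => β | _ => γ) :=
  .ax (.taut P p _ hp)

theorem imp_const : Thm Agent P (α.imp (β.imp α)) :=
  of_valid (.imp (.atom 0) (.imp (.atom 1) (.atom 0)))
    (fun _ M _ _ _ h0 _ h _ => M.mono _ _ h _ h0) α β α

theorem imp_distrib :
    Thm Agent P ((α.imp (β.imp γ)).imp ((α.imp β).imp (α.imp γ))) :=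
  of_valid (.imp (.imp (.atom 0) (.imp (.atom 1) (.atom 2)))
      (.imp (.imp (.atom 0) (.atom 1)) (.imp (.atom 0) (.atom 2))))
    (fun _ M _ _ _ h1 _ l2 h2 u l3 h3 =>
      h1 u (M.le_trans _ _ _ l2 l3) h3 u (M.le_refl u) (h2 u l3 h3)) α β γ

theorem imp_self : Thm Agent P (α.imp α) :=
  of_valid (.imp (.atom 0) (.atom 0)) (fun _ _ _ _ _ h => h) α α α

theorem and_intro : Thm Agent P (α.imp (β.imp (α.and β))) :=
  of_valid (.imp (.atom 0) (.imp (.atom 1) (.and (.atom 0) (.atom 1))))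
    (fun _ M _ _ _ h0 _ h h1 => ⟨M.mono _ _ h _ h0, h1⟩) α β α

theorem and_left : Thm Agent P ((α.and β).imp α) :=
  of_valid (.imp (.and (.atom 0) (.atom 1)) (.atom 0)) (fun _ _ _ _ _ h => h.1) α β α

theorem and_right : Thm Agent P ((α.and β).imp β) :=
  of_valid (.imp (.and (.atom 0) (.atom 1)) (.atom 1)) (fun _ _ _ _ _ h => h.2) α β α

theorem or_inl : Thm Agent P (α.imp (α.or β)) :=
  of_valid (.imp (.atom 0) (.or (.atom 0) (.atom 1))) (fun _ _ _ _ _ h => .inl h) α β α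

theorem or_inr : Thm Agent P (β.imp (α.or β)) :=
  of_valid (.imp (.atom 1) (.or (.atom 0) (.atom 1))) (fun _ _ _ _ _ h => .inr h) α β α

theorem or_elim :
    Thm Agent P ((α.imp γ).imp ((β.imp γ).imp ((α.or β).imp γ))) :=
  of_valid (.imp (.imp (.atom 0) (.atom 2))
      (.imp (.imp (.atom 1) (.atom 2)) (.imp (.or (.atom 0) (.atom 1)) (.atom 2))))
    (fun _ M _ _ _ h1 _ l2 h2 u l3 h3 =>
      h3.elim (h1 u (M.le_trans _ _ _ l2 l3)) (h2 u l3)) α β γ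

theorem bot_elim : Thm Agent P (Formula.bot.imp α) :=
  of_valid (.imp .bot (.atom 0)) (fun _ _ _ _ _ h => h.elim) α α α

end Thm

section Theories

variable {Agent : Type} [Fintype Agent] {P : Sys}

/-- A set of formulae containing all theorems and closed under modus ponens. -/
structure IsTheory (P : Sys) (T : Set (Formula Agent)) : Prop where
  of_thm : ∀ {φ}, Thm Agent P φ → φ ∈ T
  mp : ∀ {φ ψ}, φ.imp ψ ∈ T → φ ∈ T → ψ ∈ T

/-- A consistent theory with the disjunction property. -/
structure IsPrimeTheory (P : Sys) (T : Set (Formula Agent)) : Prop extends IsTheory P T where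
  bot_notMem : Formula.bot ∉ T
  prime : ∀ {φ ψ}, φ.or ψ ∈ T → φ ∈ T ∨ ψ ∈ T

theorem isTheory_setOf_thm : IsTheory P {φ | Thm Agent P φ} := ⟨id, .mp⟩

/-- The theory obtained from `T` by adjoining the assumption `α`. -/
theorem IsTheory.adjoin {T : Set (Formula Agent)} (hT : IsTheory P T) (α : Formula Agent) :
    IsTheory P {φ | α.imp φ ∈ T} where
  of_thm h := hT.mp (hT.of_thm .imp_const) (hT.of_thm h)
  mp h₁ h₂ := hT.mp (hT.mp (hT.of_thm .imp_distrib) h₁) h₂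

theorem IsTheory.subset_adjoin {T : Set (Formula Agent)} (hT : IsTheory P T)
    (α : Formula Agent) : T ⊆ {φ | α.imp φ ∈ T} :=
  fun _ h => hT.mp (hT.of_thm .imp_const) h

/-- Lindenbaum's lemma for prime theories. -/
theorem IsTheory.exists_prime {T : Set (Formula Agent)} (hT : IsTheory P T)
    {χ : Formula Agent} (hχ : χ ∉ T) : ∃ S, T ⊆ S ∧ IsPrimeTheory P S ∧ χ ∉ S := by
  obtain ⟨S, hTS, hS⟩ := zorn_subset_nonempty {S | IsTheory P S ∧ χ ∉ S} (by
    rintro c hc hchain ⟨S₀, hS₀⟩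
    refine ⟨⋃₀ c, ⟨⟨fun h => ⟨S₀, hS₀, (hc hS₀).1.of_thm h⟩, ?_⟩, ?_⟩,
      fun _ => Set.subset_sUnion_of_mem⟩
    · rintro φ ψ ⟨A, hA, h₁⟩ ⟨B, hB, h₂⟩
      rcases hchain.total hA hB with h | h
      · exact ⟨B, hB, (hc hB).1.mp (h h₁) h₂⟩
      · exact ⟨A, hA, (hc hA).1.mp h₁ (h h₂)⟩
    · rintro ⟨A, hA, h⟩
      exact (hc hA).2 h) T ⟨hT, hχ⟩
  have key : ∀ α, α ∉ S → α.imp χ ∈ S := by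
    intro α hα
    by_contra h
    exact hα (hS.le_of_ge ⟨hS.prop.1.adjoin α, h⟩ (hS.prop.1.subset_adjoin α)
      (hS.prop.1.of_thm .imp_self))
  have hth := hS.prop.1
  refine ⟨S, hTS, ⟨hth, fun h => hS.prop.2 (hth.mp (hth.of_thm .bot_elim) h), ?_⟩, hS.prop.2⟩
  intro α β h
  by_contra! hn
  exact hS.prop.2 (hth.mp (hth.mp (hth.mp (hth.of_thm .or_elim) (key α hn.1)) (key β hn.2)) h)

theorem IsTheory.imp_mem_iff {T : Set (Formula Agent)} (hT : IsTheory P T)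
    {α β : Formula Agent} :
    α.imp β ∈ T ↔ ∀ S, IsPrimeTheory P S → T ⊆ S → α ∈ S → β ∈ S := by
  refine ⟨fun h S hS hTS hα => hS.mp (hTS h) hα, fun h => ?_⟩
  by_contra hn
  obtain ⟨S, hTS, hS, hβ⟩ := (hT.adjoin α).exists_prime hn
  exact hβ (h S hS ((hT.subset_adjoin α).trans hTS) (hTS (hT.of_thm .imp_self)))

end Theories

section Slash

variable {Agent : Type} [Fintype Agent] {P : Sys}

/-- The Aczel slash for the system `P`. -/
def Slash (P : Sys) : Formula Agent → Prop
  | .bot => False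
  | .atom n => Thm Agent P (.atom n)
  | .and φ ψ => Slash P φ ∧ Slash P ψ
  | .or φ ψ => Slash P φ ∨ Slash P ψ
  | .imp φ ψ => Thm Agent P (φ.imp ψ) ∧ (Slash P φ → Slash P ψ)
  | .know a φ => Thm Agent P (.know a φ) ∧ Slash P φ
  | .ck φ => Thm Agent P (.ck φ) ∧ Slash P φ

theorem Slash.thm : ∀ {φ : Formula Agent}, Slash P φ → Thm Agent P φ
  | .bot, h => h.elim
  | .atom _, h => h
  | .and _ _, h => .mp (.mp .and_intro h.1.thm) h.2.thm
  | .or _ _, h => h.elim (fun h => .mp .or_inl h.thm) fun h => .mp .or_inr h.thm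
  | .imp _ _, h => h.1
  | .know _ _, h => h.1
  | .ck _, h => h.1

theorem Slash.efml {φ : Formula Agent} (h : ∀ a, Slash P (.know a φ)) : Slash P (Efml φ) := by
  unfold Efml
  induction (Finset.univ : Finset Agent).toList with
  | nil => exact ⟨.imp_self, id⟩
  | cons a l ih => exact ⟨h a, ih⟩

/-- The canonical model of prime theories with a new root, at which an atom is true when its
substitution instance is slashed. -/
def slashModel (P : Sys) (σ : ℕ → Formula Agent) :
    IModel (Option {T : Set (Formula Agent) // IsPrimeTheory P T}) where
  le
    | none, _ => True
    | some _, none => False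
    | some S, some T => S.1 ⊆ T.1
  le_refl
    | none => trivial
    | some _ => subset_rfl
  le_trans
    | none, _, _, _, _ => trivial
    | some _, some _, some _, h₁, h₂ => h₁.trans h₂
  V
    | none, n => Slash P (σ n)
    | some T, n => σ n ∈ T.1
  mono
    | none, none, _, _, h => h
    | none, some T, _, _, h => T.2.of_thm h.thm
    | some _, some _, h, _, hn => h hn

theorem isat_slashModel_some (σ : ℕ → Formula Agent) (p : PropForm)
    (T : {T : Set (Formula Agent) // IsPrimeTheory P T}) :
    ISat (slashModel P σ) p (some T) ↔ p.subst σ ∈ T.1 := by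
  induction p generalizing T with
  | bot => exact iff_of_false id T.2.bot_notMem
  | atom n => exact Iff.rfl
  | and p q ihp ihq =>
    refine (and_congr (ihp T) (ihq T)).trans ⟨fun h => ?_, fun h => ⟨?_, ?_⟩⟩
    · exact T.2.mp (T.2.mp (T.2.of_thm .and_intro) h.1) h.2
    · exact T.2.mp (T.2.of_thm .and_left) h
    · exact T.2.mp (T.2.of_thm .and_right) h
  | or p q ihp ihq =>
    refine (or_congr (ihp T) (ihq T)).trans ⟨fun h => h.elim ?_ ?_, T.2.prime⟩
    · exact T.2.mp (T.2.of_thm .or_inl)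
    · exact T.2.mp (T.2.of_thm .or_inr)
  | imp p q ihp ihq =>
    refine Iff.trans ⟨fun h S hS hTS hp => ?_, fun h v hv hp => ?_⟩
      T.2.toIsTheory.imp_mem_iff.symm
    · exact (ihq ⟨S, hS⟩).1 (h (some ⟨S, hS⟩) hTS ((ihp ⟨S, hS⟩).2 hp))
    · match v, hv with
      | some S, hv => exact (ihq S).2 (h S.1 S.2 hv ((ihp S).1 hp))

theorem isat_slashModel_none (σ : ℕ → Formula Agent) (p : PropForm) :
    ISat (slashModel P σ) p none ↔ Slash P (p.subst σ) := by
  induction p with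
  | bot => exact Iff.rfl
  | atom n => exact Iff.rfl
  | and p q ihp ihq => exact and_congr ihp ihq
  | or p q ihp ihq => exact or_congr ihp ihq
  | imp p q ihp ihq =>
    refine ⟨fun h => ⟨isTheory_setOf_thm.imp_mem_iff.2 fun S hS _ hp => ?_,
      fun hp => ihq.1 (h none trivial (ihp.2 hp))⟩, fun h v _ hp => ?_⟩
    · exact (isat_slashModel_some σ q ⟨S, hS⟩).1
        (h (some ⟨S, hS⟩) trivial ((isat_slashModel_some σ p ⟨S, hS⟩).2 hp))
    · match v with
      | none => exact ihq.2 (h.2 (ihp.1 hp))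
      | some S =>
        exact (isat_slashModel_some σ q S).2
          (S.2.mp (S.2.of_thm h.1) ((isat_slashModel_some σ p S).1 hp))

theorem Slash.of_ax (hP : ¬ P.hasS5) {φ : Formula Agent} (h : Ax Agent P φ) : Slash P φ := by
  have hφ : Thm Agent P φ := .ax h
  cases h with
  | taut p σ hp => exact (isat_slashModel_none σ p).1 (hp _ _ _)
  | axK a φ ψ =>
    exact ⟨hφ, fun h => ⟨.mp hφ h.1, fun h' => ⟨.mp (.mp hφ h.1) h'.1, h.2.2 h'.2⟩⟩⟩
  | fix φ =>
    exact ⟨⟨.mp .and_left hφ, fun h => ⟨h.2, .efml fun a => ⟨.nec a h.1, h⟩⟩⟩,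
      .mp .and_right hφ, fun h => ⟨.mp (.mp .and_right hφ) h.thm, h.1⟩⟩
  | axT a φ _ => exact ⟨hφ, fun h => h.2⟩
  | axS4 a φ _ => exact ⟨hφ, fun h => ⟨.mp hφ h.1, h⟩⟩
  | axKc a φ ψ h => exact (hP h).elim
  | axS5 a φ h => exact (hP h).elim

theorem Slash.of_thm (hP : ¬ P.hasS5) {φ : Formula Agent} (h : Thm Agent P φ) : Slash P φ := by
  induction h with
  | ax h => exact .of_ax hP h
  | mp _ _ ih₁ ih₂ => exact ih₁.2 ih₂
  | nec a h ih => exact ⟨.nec a h, ih⟩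
  | mon h ih => exact ⟨.mon h, fun h' => ⟨.mp (.mon h) h'.1, ih.2 h'.2⟩⟩
  | ind h _ => exact ⟨.ind h, fun h' => ⟨.mp (.ind h) h'.thm, h'⟩⟩

end Slash

theorem Deriv.thm_of_empty {Agent : Type} [Fintype Agent] {P : Sys} {φ : Formula Agent}
    (h : Deriv Agent P ∅ φ) : Thm Agent P φ := by
  induction h with
  | assum h => exact h.elim
  | thm h => exact h
  | mp _ _ ih₁ ih₂ => exact .mp ih₁ ih₂

/-- Syntactic Disjunction Property for ICK, ICKT and ICKS4. -/
theorem syntactic_disjunction_property (Agent : Type) [Fintype Agent] [Nonempty Agent]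
    (P : Sys) (hP : P = Sys.ick ∨ P = Sys.ickt ∨ P = Sys.icks4)
    (φ ψ : Formula Agent) (h : Deriv Agent P ∅ (φ.or ψ)) :
    Deriv Agent P ∅ φ ∨ Deriv Agent P ∅ ψ := by
  have hS5 : ¬ P.hasS5 := by
    rcases hP with rfl | rfl | rfl <;> exact id
  exact (Slash.of_thm hS5 h.thm_of_empty).imp (fun h => .thm h.thm) fun h => .thm h.thm

end ICK
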